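/- Let F = ℚ(t) be the field of rational functions in one variable t over ℚ and fix γ ∈ F. If ψ is any function from Young diagrams to F satisfying, for every nonempty Young diagram μ, the recursion (t − t^{−1}) · C_μ(t) · ψ_μ = γ · Σ_{λ : λ+□=μ} ψ_λ, then for every Young diagram λ one has ψ_λ = ψ_∅ · γ^{|λ|} · ∏_{□∈λ} t^{−c(□)} / (t^{h(□)} − t^{−h(□)}). In particular any solution of the recursion is a scalar multiple of the hook-content solution. -/

import Mathlib

open Finset

/-- The content of a cell `(i, j)` (0-indexed) of a Young diagram: `j - i`. -/
def cellContent (c : ℕ × ℕ) : ℤ := (c.2 : ℤ) - (c.1 : ℤ)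

/-- The arm length of a cell: number of cells strictly to its right in its row. -/
def armLen (μ : YoungDiagram) (c : ℕ × ℕ) : ℕ := μ.rowLen c.1 - (c.2 + 1)

/-- The leg length of a cell: number of cells strictly below it in its column. -/
def legLen (μ : YoungDiagram) (c : ℕ × ℕ) : ℕ := μ.colLen c.2 - (c.1 + 1)

/-- The hook length of a cell: arm + leg + 1. -/
def hookLen (μ : YoungDiagram) (c : ℕ × ℕ) : ℕ := armLen μ c + legLen μ c + 1

/-- `AddCell l m` means `m` is obtained from `l` by adding exactly one cell. -/
def AddCell (l m : YoungDiagram) : Prop := l.cells ⊆ m.cells ∧ m.card = l.card + 1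

/-- The content of the unique cell of `m` not in `l` (when `AddCell l m`),
expressed as the sum over the one-element difference `m \ l`. -/
def newContent (l m : YoungDiagram) : ℤ := ∑ c ∈ m.cells \ l.cells, cellContent c

/-- The variable `t` of the field `ℚ(t)` of rational functions. -/
noncomputable def t : RatFunc ℚ := RatFunc.X

/-- The content polynomial `c_μ(q) = Σ_{□∈μ} q^{c(□)}` evaluated at `q = t²`,
as an element of `ℚ(t)`. -/
noncomputable def contentPolyT (μ : YoungDiagram) : RatFunc ℚ :=
  ∑ c ∈ μ.cells, t ^ (2 * cellContent c)

/-- The hook-content solution `ψ_λ = γ^{|λ|} ∏_{□∈λ} t^{-c(□)}/(t^{h(□)} - t^{-h(□)})`. -/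
noncomputable def psi (γ : RatFunc ℚ) (l : YoungDiagram) : RatFunc ℚ :=
  γ ^ l.card * ∏ c ∈ l.cells,
    t ^ (-cellContent c) / (t ^ (hookLen l c : ℤ) - t ^ (-(hookLen l c : ℤ)))

/-! Helper material. -/

noncomputable def br (a : ℤ) : RatFunc ℚ := t ^ a - t ^ (-a)

theorem t_ne : t ≠ 0 := RatFunc.X_ne_zero

theorem t_npow (k : ℕ) (h : t ^ k = 1) : k = 0 := by
  unfold t at h
  rw [← RatFunc.algebraMap_X, ← map_pow, ← map_one (algebraMap (Polynomial ℚ) (RatFunc ℚ))] at h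
  have h2 := RatFunc.algebraMap_injective ℚ h
  have := congrArg Polynomial.natDegree h2
  simpa using this

theorem t_zpow (a : ℤ) (h : t ^ a = 1) : a = 0 := by
  obtain ⟨k, rfl | rfl⟩ := a.eq_nat_or_neg
  · rw [zpow_natCast] at h
    simp [t_npow k h]
  · rw [zpow_neg, zpow_natCast, inv_eq_one] at h
    simp [t_npow k h]

theorem t_zpow_inj {a b : ℤ} (h : t ^ a = t ^ b) : a = b := by
  have : t ^ (a - b) = 1 := by
    rw [zpow_sub₀ t_ne, h, div_self (zpow_ne_zero _ t_ne)]
  have := t_zpow _ this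
  omega

theorem br_ne {a : ℤ} (h : a ≠ 0) : br a ≠ 0 := by
  intro h1
  have := t_zpow_inj (sub_eq_zero.1 h1)
  omega

theorem br_neg (a : ℤ) : br (-a) = - br a := by
  simp [br]

theorem content_ne (μ : YoungDiagram) (hμ : μ.cells.Nonempty) : contentPolyT μ ≠ 0 := by
  set N : ℕ := ∑ c ∈ μ.cells, c.1 with hN
  have key : contentPolyT μ * t ^ (2 * N) =
      algebraMap (Polynomial ℚ) (RatFunc ℚ)
        (∑ c ∈ μ.cells, Polynomial.X ^ (2 * c.2 + 2 * (N - c.1))) := by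
    unfold contentPolyT
    rw [Finset.sum_mul, map_sum]
    refine Finset.sum_congr rfl fun c hc => ?_
    have hle : c.1 ≤ N := Finset.single_le_sum (f := fun c : ℕ × ℕ => c.1) (fun _ _ => Nat.zero_le _) hc
    rw [map_pow, RatFunc.algebraMap_X]
    change _ = t ^ _
    rw [← zpow_natCast, ← zpow_natCast, ← zpow_add₀ t_ne]
    congr 1
    unfold cellContent
    push_cast [Nat.cast_sub hle]
    ring
  intro h0
  rw [h0, zero_mul] at key
  have h1 := (map_eq_zero_iff _ (RatFunc.algebraMap_injective ℚ)).1 key.symm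
  have h2 := congrArg (Polynomial.eval 1) h1
  simp [Polynomial.eval_finsetSum] at h2
  simp [h2] at hμ

theorem cell_iff (μ : YoungDiagram) (i j : ℕ) : j < μ.rowLen i ↔ i < μ.colLen j := by
  rw [← YoungDiagram.mem_iff_lt_rowLen, YoungDiagram.mem_iff_lt_colLen]

/-- beta number -/
def bt (μ : YoungDiagram) (n i : ℕ) : ℤ := μ.rowLen i + n - 1 - i

theorem row_hooks (μ : YoungDiagram) (n i : ℕ) (hn : μ.rowLen n = 0) (hi : i < n) :
    (∏ j ∈ range (μ.rowLen i), br (hookLen μ (i, j))) * ∏ k ∈ Ioo i n, br (bt μ n i - bt μ n k)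
      = ∏ m ∈ range (μ.rowLen i + (n - 1 - i)), br (m + 1) := by
  set f : ℕ → ℕ := fun j => armLen μ (i, j) + legLen μ (i, j) with hf
  set g : ℕ → ℕ := fun k => μ.rowLen i - μ.rowLen k + (k - i - 1) with hg
  have hanti := μ.rowLen_anti
  have hcanti := μ.colLen_anti
  have hc := cell_iff μ
  have fi : Set.InjOn f (range (μ.rowLen i)) := by
    intro a ha b hb hab
    simp only [coe_range, Set.mem_Iio] at ha hb
    simp only [hf, armLen, legLen] at hab
    have h1 := (hc i a).1 ha
    have h2 := (hc i b).1 hb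
    rcases lt_trichotomy a b with h | h | h
    · have := hcanti a b h.le
      omega
    · exact h
    · have := hcanti b a h.le
      omega
  have gi : Set.InjOn g (Ioo i n) := by
    intro a ha b hb hab
    simp only [coe_Ioo, Set.mem_Ioo] at ha hb
    simp only [hg] at hab
    have h1 := hanti i a ha.1.le
    have h2 := hanti i b hb.1.le
    rcases lt_trichotomy a b with h | h | h
    · have := hanti a b h.le
      omega
    · exact h
    · have := hanti b a h.le
      omega
  have hdisj : Disjoint ((range (μ.rowLen i)).image f) ((Ioo i n).image g) := by
    rw [Finset.disjoint_left]
    intro x hx hx'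
    simp only [Finset.mem_image, Finset.mem_range, Finset.mem_Ioo] at hx hx'
    obtain ⟨j, hj, rfl⟩ := hx
    obtain ⟨k, hk, hkj⟩ := hx'
    simp only [hf, hg, armLen, legLen] at hkj
    have h1 := (hc i j).1 hj
    have h2 := hc k j
    have h3 := hanti i k hk.1.le
    by_cases h : j < μ.rowLen k
    · have := h2.1 h
      omega
    · have : ¬ k < μ.colLen j := fun h' => h (h2.2 h')
      omega
  have hsub : (range (μ.rowLen i)).image f ∪ (Ioo i n).image g
      = range (μ.rowLen i + (n - 1 - i)) := by
    apply Finset.eq_of_subset_of_card_le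
    · intro x hx
      simp only [Finset.mem_union, Finset.mem_image, Finset.mem_range, Finset.mem_Ioo] at hx ⊢
      rcases hx with ⟨j, hj, rfl⟩ | ⟨k, hk, rfl⟩
      · simp only [hf, armLen, legLen]
        have h1 := (hc i j).1 hj
        have h2 : ¬ n < μ.colLen j := fun h' => by
          have := (hc n j).2 h'
          omega
        omega
      · simp only [hg]
        by_cases h0 : μ.rowLen k = 0
        · omega
        · have := hanti i k hk.1.le
          omega
    · rw [Finset.card_union_of_disjoint hdisj, Finset.card_image_of_injOn fi,
        Finset.card_image_of_injOn gi]
      simp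
      omega
  rw [← hsub, Finset.prod_union hdisj, Finset.prod_image fi, Finset.prod_image gi]
  congr 1
  refine Finset.prod_congr rfl fun k hk => ?_
  congr 1
  simp only [Finset.mem_Ioo] at hk
  have := hanti i k hk.1.le
  simp only [hg, bt]
  omega

theorem bt_lt (μ : YoungDiagram) (n : ℕ) {i k : ℕ} (h : i < k) : bt μ n k < bt μ n i := by
  have := μ.rowLen_anti i k h.le
  unfold bt
  omega

theorem bt_ne (μ : YoungDiagram) (n : ℕ) {i k : ℕ} (h : i ≠ k) : bt μ n i - bt μ n k ≠ 0 := by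
  rcases lt_or_gt_of_ne h with h | h
  · have := bt_lt μ n h
    omega
  · have := bt_lt μ n h
    omega

theorem cells_prod (μ : YoungDiagram) (n : ℕ) (hn : μ.rowLen n = 0) (F : ℕ × ℕ → RatFunc ℚ) :
    ∏ c ∈ μ.cells, F c = ∏ i ∈ range n, ∏ j ∈ range (μ.rowLen i), F (i, j) := by
  refine Finset.prod_finset_product _ _ _ ?_
  rintro ⟨i, j⟩
  simp only [YoungDiagram.mem_cells, YoungDiagram.mem_iff_lt_rowLen, Finset.mem_range]
  refine ⟨fun h => ⟨?_, h⟩, fun h => h.2⟩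
  by_contra h'
  have := μ.rowLen_anti n i (by omega)
  omega

theorem cells_sum (μ : YoungDiagram) (n : ℕ) (hn : μ.rowLen n = 0) (F : ℕ × ℕ → RatFunc ℚ) :
    ∑ c ∈ μ.cells, F c = ∑ i ∈ range n, ∑ j ∈ range (μ.rowLen i), F (i, j) := by
  refine Finset.sum_finset_product _ _ _ ?_
  rintro ⟨i, j⟩
  simp only [YoungDiagram.mem_cells, YoungDiagram.mem_iff_lt_rowLen, Finset.mem_range]
  refine ⟨fun h => ⟨?_, h⟩, fun h => h.2⟩
  by_contra h'
  have := μ.rowLen_anti n i (by omega)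
  omega

noncomputable def hp (μ : YoungDiagram) : RatFunc ℚ := ∏ c ∈ μ.cells, br (hookLen μ c)

theorem hp_ne (μ : YoungDiagram) : hp μ ≠ 0 := by
  unfold hp
  refine Finset.prod_ne_zero_iff.2 fun c _ => br_ne ?_
  simp only [hookLen]
  omega

noncomputable def rq (μ : YoungDiagram) (n i : ℕ) : RatFunc ℚ :=
  (∏ m ∈ range (μ.rowLen i + (n - 1 - i)), br (m + 1)) / ∏ k ∈ Ioo i n, br (bt μ n i - bt μ n k)

theorem hp_eq (μ : YoungDiagram) (n : ℕ) (hn : μ.rowLen n = 0) :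
    hp μ = ∏ i ∈ range n, rq μ n i := by
  unfold hp
  rw [cells_prod μ n hn]
  refine Finset.prod_congr rfl fun i hi => ?_
  unfold rq
  rw [eq_div_iff, row_hooks μ n i hn (by simpa using hi)]
  refine Finset.prod_ne_zero_iff.2 fun k hk => br_ne (bt_ne _ _ ?_)
  simp at hk
  omega

/-- the weight factor -/
noncomputable def wt (μ : YoungDiagram) (n r j : ℕ) : RatFunc ℚ :=
  br (bt μ n r - 1 - bt μ n j) / br (bt μ n r - bt μ n j)

theorem hp_ratio (μ l : YoungDiagram) (n r : ℕ) (hn : μ.rowLen n = 0) (hr : r < n)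
    (h1 : l.rowLen r + 1 = μ.rowLen r) (h2 : ∀ i, i ≠ r → l.rowLen i = μ.rowLen i) :
    hp μ = hp l * (br (bt μ n r) * ∏ j ∈ (range n).erase r, wt μ n r j) := by
  have hn' : l.rowLen n = 0 := by rw [h2 n (by omega), hn]
  have hb : bt l n r = bt μ n r - 1 := by unfold bt; omega
  have hb2 : ∀ i, i ≠ r → bt l n i = bt μ n i := fun i hi => by unfold bt; rw [h2 i hi]
  rw [hp_eq μ n hn, hp_eq l n hn']
  have hrm : r ∈ range n := by simpa using hr
  have hnz : ∀ i, ∏ k ∈ Ioo i n, br (bt μ n i - bt μ n k) ≠ 0 := fun i => by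
    refine Finset.prod_ne_zero_iff.2 fun k hk => br_ne (bt_ne _ _ ?_)
    simp at hk
    omega
  have hnz' : ∀ i, ∏ k ∈ Ioo i n, br (bt l n i - bt l n k) ≠ 0 := fun i => by
    refine Finset.prod_ne_zero_iff.2 fun k hk => br_ne (bt_ne _ _ ?_)
    simp at hk
    omega
  have hgt : ∀ i, r < i → rq μ n i = rq l n i := by
    intro i hi
    unfold rq
    rw [h2 i (by omega)]
    congr 1
    refine Finset.prod_congr rfl fun k hk => ?_
    simp at hk
    rw [hb2 i (by omega), hb2 k (by omega)]
  have hlt : ∀ i, i < r → rq μ n i = rq l n i * wt μ n r i := by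
    intro i hi
    unfold rq
    rw [h2 i (by omega)]
    have hri : r ∈ Ioo i n := by simp; omega
    have e : ∏ k ∈ (Ioo i n).erase r, br (bt l n i - bt l n k)
        = ∏ k ∈ (Ioo i n).erase r, br (bt μ n i - bt μ n k) := by
      refine Finset.prod_congr rfl fun k hk => ?_
      simp at hk
      rw [hb2 i (by omega), hb2 k (by omega)]
    have a1 := hnz i
    have a2 := hnz' i
    rw [← Finset.mul_prod_erase _ _ hri] at a1 a2 ⊢
    rw [← Finset.mul_prod_erase _ _ hri]
    rw [e] at a2 ⊢
    have b1 := left_ne_zero_of_mul a1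
    have b2 := left_ne_zero_of_mul a2
    have b3 := right_ne_zero_of_mul a1
    have e1 : br (bt μ n r - 1 - bt μ n i) = - br (bt l n i - bt l n r) := by
      rw [← br_neg, hb, hb2 i (by omega)]
      congr 1
      ring
    have e2 : br (bt μ n r - bt μ n i) = - br (bt μ n i - bt μ n r) := by
      rw [← br_neg]
      congr 1
      ring
    unfold wt
    rw [e1, e2]
    field_simp
  have heq : rq μ n r = rq l n r * (br (bt μ n r) * ∏ j ∈ Ioo r n, wt μ n r j) := by
    unfold rq wt
    rw [← h1, show l.rowLen r + 1 + (n - 1 - r) = (l.rowLen r + (n - 1 - r)) + 1 by ring,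
      Finset.prod_range_succ, Finset.prod_div_distrib]
    have e1 : ∏ k ∈ Ioo r n, br (bt μ n r - 1 - bt μ n k) = ∏ k ∈ Ioo r n, br (bt l n r - bt l n k) := by
      refine Finset.prod_congr rfl fun k hk => ?_
      simp at hk
      rw [hb, hb2 k (by omega)]
    have e2 : (((l.rowLen r + (n - 1 - r) : ℕ) : ℤ) + 1) = bt μ n r := by
      unfold bt
      omega
    rw [e1, e2]
    have := hnz r
    have := hnz' r
    field_simp
  have hsplit : ∀ F : ℕ → RatFunc ℚ, ∏ i ∈ (range n).erase r, F i
      = (∏ i ∈ range r, F i) * ∏ i ∈ Ioo r n, F i := by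
    intro F
    rw [← Finset.prod_union]
    · congr 1
      ext x
      simp
      omega
    · rw [Finset.disjoint_left]
      intro x
      simp
      omega
  rw [← Finset.mul_prod_erase _ _ hrm, ← Finset.mul_prod_erase _ (rq l n) hrm, hsplit, hsplit, hsplit,
    heq]
  rw [Finset.prod_congr rfl (fun i hi => hgt i (Finset.mem_Ioo.1 hi).1),
    Finset.prod_congr rfl (fun i hi => hlt i (Finset.mem_range.1 hi)), Finset.prod_mul_distrib]
  ring

section lagr
open Polynomial

theorem lag_deg {K : Type*} [Field K] (s : Finset ℕ) (x : ℕ → K) (q : K) :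
    ((∏ j ∈ s, (X - C (q * x j))) - ∏ j ∈ s, (X - C (x j)) : K[X]).degree < #s := by
  have m1 : (∏ j ∈ s, (X - C (q * x j)) : K[X]).Monic := monic_prod_of_monic _ _ fun j _ => monic_X_sub_C _
  have m2 : (∏ j ∈ s, (X - C (x j)) : K[X]).Monic := monic_prod_of_monic _ _ fun j _ => monic_X_sub_C _
  have d1 : (∏ j ∈ s, (X - C (q * x j)) : K[X]).degree = #s := by
    rw [degree_prod, Finset.sum_congr rfl (fun j _ => degree_X_sub_C _)]; simp
  have d2 : (∏ j ∈ s, (X - C (x j)) : K[X]).degree = #s := by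
    rw [degree_prod]; simp
  rw [← d1]
  exact degree_sub_lt_left (d1.trans d2.symm) m1.ne_zero (by rw [m1.leadingCoeff, m2.leadingCoeff])

theorem lag_eval {K : Type*} [Field K] (s : Finset ℕ) (x : ℕ → K) (q : K) (i : ℕ) (hi : i ∈ s) :
    ((∏ j ∈ s, (X - C (q * x j))) - ∏ j ∈ s, (X - C (x j)) : K[X]).eval (x i)
      = (1 - q) * x i * ∏ j ∈ s.erase i, (x i - q * x j) := by
  rw [eval_sub, eval_prod, eval_prod, Finset.prod_eq_zero (s := s) (f := fun j => eval (x i) (X - C (x j))) (i := i) hi (by simp),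
    ← Finset.mul_prod_erase _ _ hi]
  simp only [eval_sub, eval_X, eval_C]
  ring

theorem lagA {K : Type*} [Field K] (s : Finset ℕ) (x : ℕ → K) (hx : Set.InjOn x s) (q : K)
    (hq : 1 - q ≠ 0) :
    ∑ i ∈ s, x i * ∏ j ∈ s.erase i, ((x i - q * x j) / (x i - x j)) = ∑ i ∈ s, x i := by
  rcases s.eq_empty_or_nonempty with rfl | hs
  · simp
  have h := Lagrange.coeff_eq_sum hx (lag_deg s x q)
  rw [coeff_sub, prod_X_sub_C_coeff_card_pred _ _ hs.card_pos,
    prod_X_sub_C_coeff_card_pred _ _ hs.card_pos, ← Finset.mul_sum] at h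
  apply mul_left_cancel₀ hq
  rw [Finset.mul_sum]
  trans -(q * ∑ i ∈ s, x i) - -∑ i ∈ s, x i
  · rw [h]
    refine Finset.sum_congr rfl fun i hi => ?_
    rw [lag_eval s x q i hi, Finset.prod_div_distrib]
    ring
  · ring

theorem lagB {K : Type*} [Field K] (s : Finset ℕ) (x : ℕ → K) (hx : Set.InjOn x s) (q : K)
    (hq : 1 - q ≠ 0) (h0 : ∀ i ∈ s, x i ≠ 0) :
    ∑ i ∈ s, ∏ j ∈ s.erase i, ((x i - q * x j) / (x i - x j)) = ∑ k ∈ range #s, q ^ k := by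
  have h := Lagrange.eq_interpolate hx (lag_deg s x q)
  rw [Lagrange.interpolate_eq_sum] at h
  have h := congrArg (eval 0) h
  rw [eval_sub, eval_prod, eval_prod, eval_finsetSum] at h
  simp only [eval_sub, eval_X, eval_C, zero_sub, ← mul_neg, eval_mul, eval_prod] at h
  rw [Finset.prod_mul_distrib, Finset.prod_const] at h
  have hP : ∏ i ∈ s, (- x i) ≠ 0 := Finset.prod_ne_zero_iff.2 fun i hi => neg_ne_zero.2 (h0 i hi)
  have h3 : (q ^ #s - 1) * ∏ i ∈ s, (-x i) =
      ((q - 1) * ∑ i ∈ s, ∏ j ∈ s.erase i, ((x i - q * x j) / (x i - x j))) * ∏ i ∈ s, (-x i) := by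
    rw [sub_mul, one_mul, h, Finset.mul_sum, Finset.sum_mul]
    refine Finset.sum_congr rfl fun i hi => ?_
    have := lag_eval s x q i hi
    simp only [eval_sub, eval_prod, eval_X, eval_C] at this
    rw [this, Finset.prod_div_distrib, ← Finset.mul_prod_erase s (fun i => - x i) hi]
    ring
  have h4 := mul_right_cancel₀ hP h3
  have h5 := geom_sum_mul q #s
  have hq' : q - 1 ≠ 0 := fun h => hq (by linear_combination -h)
  apply mul_left_cancel₀ hq'
  rw [← h4, ← h5]
  ring

end lagr

theorem q_ne : (1 : RatFunc ℚ) - t ^ 2 ≠ 0 := by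
  intro h
  have := t_npow 2 (by linear_combination -h)
  omega

/-- ratio term -/
noncomputable def tm (μ : YoungDiagram) (n r : ℕ) : RatFunc ℚ :=
  t ^ (bt μ n r - n) * (br (bt μ n r) * ∏ j ∈ (range n).erase r, wt μ n r j)

noncomputable def xx (μ : YoungDiagram) (n i : ℕ) : RatFunc ℚ := t ^ (2 * bt μ n i)

theorem wt_eq (μ : YoungDiagram) (n r j : ℕ) (h : r ≠ j) :
    wt μ n r j = t⁻¹ * ((xx μ n r - t ^ 2 * xx μ n j) / (xx μ n r - xx μ n j)) := by
  have h1 := br_ne (bt_ne μ n h)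
  have h2 : xx μ n r - xx μ n j ≠ 0 := by
    intro h'
    have := t_zpow_inj (sub_eq_zero.1 h')
    have := bt_ne μ n h
    omega
  have ht := t_ne
  have hti : t⁻¹ * t = 1 := inv_mul_cancel₀ ht
  unfold wt
  rw [mul_div_assoc', div_eq_div_iff h1 h2]
  unfold xx br
  generalize bt μ n r = a
  generalize bt μ n j = b
  have e1 : a - 1 - b = a + (-1) + -b := by ring
  have e2 : -(a - 1 - b) = -a + 1 + b := by ring
  have e3 : a - b = a + - b := by ring
  have e4 : -(a - b) = -a + b := by ring
  rw [e2, e4, e1, e3]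
  simp only [zpow_add₀ ht, zpow_one, two_mul, zpow_neg]
  have ha := zpow_ne_zero a ht
  have hb := zpow_ne_zero b ht
  field_simp

theorem tm_eq (μ : YoungDiagram) (n r : ℕ) (hr : r < n) :
    tm μ n r = t ^ (1 - 2 * n : ℤ) * ((xx μ n r - 1) *
      ∏ j ∈ (range n).erase r, ((xx μ n r - t ^ 2 * xx μ n j) / (xx μ n r - xx μ n j))) := by
  have ht := t_ne
  unfold tm
  rw [Finset.prod_congr rfl (fun j hj => wt_eq μ n r j (Finset.ne_of_mem_erase hj).symm),
    Finset.prod_mul_distrib, Finset.prod_const, Finset.card_erase_of_mem (by simpa using hr), card_range]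
  have e : t ^ (bt μ n r - n) * br (bt μ n r) * t⁻¹ ^ (n - 1) = t ^ (1 - 2 * n : ℤ) * (xx μ n r - 1) := by
    rw [inv_pow, ← zpow_natCast, ← zpow_neg]
    unfold br xx
    rw [Nat.cast_sub (by omega)]
    rw [mul_sub, sub_mul, mul_sub, ← zpow_add₀ ht, ← zpow_add₀ ht, ← zpow_add₀ ht, ← zpow_add₀ ht, mul_one,
      ← zpow_add₀ ht]
    congr 2 <;> push_cast <;> ring
  linear_combination (∏ j ∈ (range n).erase r, ((xx μ n r - t ^ 2 * xx μ n j) / (xx μ n r - xx μ n j))) * e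

theorem content_eq (μ : YoungDiagram) (n : ℕ) (hn : μ.rowLen n = 0) :
    (t - t⁻¹) * contentPolyT μ =
      t ^ (1 - 2 * n : ℤ) * (∑ i ∈ range n, xx μ n i - ∑ k ∈ range n, (t ^ 2) ^ k) := by
  have ht := t_ne
  unfold contentPolyT
  rw [cells_sum μ n hn, Finset.mul_sum, ← Finset.sum_range_reflect (fun k => (t ^ 2) ^ k),
    ← Finset.sum_sub_distrib, Finset.mul_sum]
  refine Finset.sum_congr rfl fun i hi => ?_
  have hi' : i < n := by simpa using hi
  have e : ∑ j ∈ range (μ.rowLen i), t ^ (2 * cellContent (i, j))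
      = t ^ (-2 * i : ℤ) * ∑ j ∈ range (μ.rowLen i), (t ^ 2) ^ j := by
    rw [Finset.mul_sum]
    refine Finset.sum_congr rfl fun j _ => ?_
    rw [← pow_mul, ← zpow_natCast, ← zpow_add₀ ht]
    congr 1
    simp only [cellContent]
    push_cast
    ring
  have e2 : (t - t⁻¹) = t⁻¹ * (t ^ 2 - 1) := by field_simp
  have g := geom_sum_mul (t ^ 2) (μ.rowLen i)
  rw [e, e2]
  trans t⁻¹ * t ^ (-2 * i : ℤ) * ((t ^ 2) ^ μ.rowLen i - 1)
  · rw [← g]; ring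
  · unfold xx
    rw [← pow_mul, ← pow_mul, ← zpow_natCast, ← zpow_natCast, ← zpow_neg_one, ← zpow_add₀ ht, mul_sub, mul_sub,
      ← zpow_add₀ ht, ← zpow_add₀ ht, ← zpow_add₀ ht, mul_one]
    unfold bt
    congr 2
    · push_cast; ring
    · rw [show n - 1 - i = n - (1 + i) by omega, Nat.cast_mul, Nat.cast_sub (by omega)]
      push_cast; ring

theorem tm_sum (μ : YoungDiagram) (n : ℕ) (hn : μ.rowLen n = 0) :
    ∑ r ∈ range n, tm μ n r = (t - t⁻¹) * contentPolyT μ := by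
  have inj : Set.InjOn (xx μ n) (range n) := by
    intro a _ b _ hab
    by_contra h
    have := t_zpow_inj hab
    have := bt_ne μ n h
    omega
  rw [content_eq μ n hn, Finset.sum_congr rfl (fun r hr => tm_eq μ n r (Finset.mem_range.1 hr)),
    ← Finset.mul_sum]
  congr 1
  have hA := lagA (range n) (xx μ n) inj (t ^ 2) q_ne
  have hB := lagB (range n) (xx μ n) inj (t ^ 2) q_ne (fun i _ => zpow_ne_zero _ t_ne)
  rw [card_range] at hB
  rw [← hA, ← hB, ← Finset.sum_sub_distrib]
  refine Finset.sum_congr rfl fun i _ => ?_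
  ring

theorem tm_zero (μ : YoungDiagram) (n r : ℕ) (hn : μ.rowLen n = 0) (hr : r < n)
    (h : μ.rowLen (r + 1) = μ.rowLen r) : tm μ n r = 0 := by
  unfold tm
  have b0 : br 0 = 0 := by simp [br]
  by_cases hr1 : r + 1 < n
  · rw [Finset.prod_eq_zero (i := r + 1) (by simp [hr1])]
    · simp
    · unfold wt bt
      rw [h]
      rw [show ((μ.rowLen r : ℤ) + n - 1 - r - 1 - (μ.rowLen r + n - 1 - ((r + 1 : ℕ) : ℤ))) = 0 by
        push_cast; ring, b0, zero_div]
  · have : r + 1 = n := by omega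
    have : bt μ n r = 0 := by
      unfold bt
      rw [← h, this, hn]
      omega
    rw [this, b0]
    simp

/-- the hook-content product -/
noncomputable def ph (l : YoungDiagram) : RatFunc ℚ := ∏ c ∈ l.cells,
    t ^ (-cellContent c) / (t ^ (hookLen l c : ℤ) - t ^ (-(hookLen l c : ℤ)))

theorem ph_eq (l : YoungDiagram) : ph l = (∏ c ∈ l.cells, t ^ (-cellContent c)) / hp l := by
  unfold ph hp
  rw [Finset.prod_div_distrib]
  rfl

def rm (μ : YoungDiagram) (r : ℕ) : YoungDiagram :=
  if h : μ.rowLen (r + 1) < μ.rowLen r then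
    { cells := μ.cells.erase (r, μ.rowLen r - 1)
      isLowerSet := by
        rintro ⟨a, b⟩ ⟨c, d⟩ hle hm
        simp only [coe_erase, Set.mem_sdiff, Finset.mem_coe, YoungDiagram.mem_cells,
          Set.mem_singleton_iff, Prod.mk.injEq] at hm ⊢
        obtain ⟨h1, h2⟩ := Prod.mk_le_mk.1 hle
        refine ⟨μ.up_left_mem h1 h2 hm.1, ?_⟩
        rintro ⟨rfl, rfl⟩
        apply hm.2
        have h3 := YoungDiagram.mem_iff_lt_rowLen.1 hm.1
        rcases Nat.eq_or_lt_of_le h1 with h4 | h4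
        · subst h4
          exact ⟨rfl, by omega⟩
        · have := μ.rowLen_anti (c + 1) a h4
          omega }
  else ⊥

theorem rm_cells (μ : YoungDiagram) (r : ℕ) (h : μ.rowLen (r + 1) < μ.rowLen r) :
    (rm μ r).cells = μ.cells.erase (r, μ.rowLen r - 1) := by
  unfold rm
  rw [dif_pos h]

theorem corner_mem (μ : YoungDiagram) (r : ℕ) (h : μ.rowLen (r + 1) < μ.rowLen r) :
    (r, μ.rowLen r - 1) ∈ μ.cells := by
  rw [YoungDiagram.mem_cells, YoungDiagram.mem_iff_lt_rowLen]
  omega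

theorem rm_lt (μ : YoungDiagram) (r : ℕ) (h : μ.rowLen (r + 1) < μ.rowLen r) (i j : ℕ) :
    j < (rm μ r).rowLen i ↔ j < μ.rowLen i ∧ ¬ (i = r ∧ j = μ.rowLen r - 1) := by
  rw [← YoungDiagram.mem_iff_lt_rowLen, ← YoungDiagram.mem_iff_lt_rowLen, ← YoungDiagram.mem_cells,
    rm_cells μ r h, Finset.mem_erase, YoungDiagram.mem_cells, Ne, Prod.mk.injEq]
  tauto

theorem ph_rm (μ : YoungDiagram) (n r : ℕ) (hn : μ.rowLen n = 0) (hr : r < n)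
    (h : μ.rowLen (r + 1) < μ.rowLen r) : ph (rm μ r) = ph μ * tm μ n r := by
  have hl := rm_lt μ r h
  have h1 : (rm μ r).rowLen r + 1 = μ.rowLen r := by
    have a1 := hl r ((rm μ r).rowLen r)
    have a2 := hl r (μ.rowLen r - 1)
    have a3 := hl r (μ.rowLen r - 2)
    omega
  have h2 : ∀ i, i ≠ r → (rm μ r).rowLen i = μ.rowLen i := by
    intro i hi
    have a1 := hl i ((rm μ r).rowLen i)
    have a2 := hl i (μ.rowLen i)
    omega
  have hh := hp_ratio μ (rm μ r) n r hn hr h1 h2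
  have n1 := hp_ne μ
  have n2 := hp_ne (rm μ r)
  rw [ph_eq, ph_eq, rm_cells μ r h, ← Finset.mul_prod_erase _ _ (corner_mem μ r h)]
  unfold tm
  set W := br (bt μ n r) * ∏ j ∈ (range n).erase r, wt μ n r j
  have e : t ^ (-cellContent (r, μ.rowLen r - 1)) * t ^ (bt μ n r - n) = 1 := by
    rw [← zpow_add₀ t_ne, ← zpow_zero t]
    congr 1
    simp only [cellContent, bt]
    omega
  rw [div_mul_eq_mul_div, div_eq_div_iff n2 n1, hh]
  linear_combination -((∏ c ∈ μ.cells.erase (r, μ.rowLen r - 1), t ^ (-cellContent c)) * hp (rm μ r) * W) * e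

theorem addCell_set (μ : YoungDiagram) (n : ℕ) (hn : μ.rowLen n = 0) :
    {l : YoungDiagram | AddCell l μ} =
      rm μ '' ((range n).filter (fun r => μ.rowLen (r + 1) < μ.rowLen r) : Finset ℕ) := by
  ext l
  simp only [Set.mem_ofPred_eq, Set.mem_image, Finset.coe_filter, Finset.mem_range]
  constructor
  · rintro ⟨hsub, hc⟩
    have hcard : (μ.cells \ l.cells).card = 1 := by
      rw [Finset.card_sdiff_of_subset hsub]
      change μ.card - l.card = 1
      omega
    obtain ⟨⟨r, s⟩, hs⟩ := Finset.card_eq_one.1 hcard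
    have hmem : ∀ i j, ((i, j) ∈ μ ∧ (i, j) ∉ l) ↔ (i = r ∧ j = s) := by
      intro i j
      have := Finset.ext_iff.1 hs (i, j)
      simpa using this
    have hsub' : ∀ i j, (i, j) ∈ l → (i, j) ∈ μ := fun i j h => hsub h
    have hrs := (hmem r s).2 ⟨rfl, rfl⟩
    have k1 : (r, s + 1) ∉ μ := fun h => by
      have h' : (r, s + 1) ∈ l := by
        by_contra h'
        have := (hmem _ _).1 ⟨h, h'⟩
        omega
      exact hrs.2 (l.up_left_mem le_rfl (Nat.le_succ s) h')
    have k2 : (r + 1, s) ∉ μ := fun h => by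
      have h' : (r + 1, s) ∈ l := by
        by_contra h'
        have := (hmem _ _).1 ⟨h, h'⟩
        omega
      exact hrs.2 (l.up_left_mem (Nat.le_succ r) le_rfl h')
    have k3 := hrs.1
    rw [YoungDiagram.mem_iff_lt_rowLen] at k1 k2 k3
    have hcor : μ.rowLen (r + 1) < μ.rowLen r := by omega
    refine ⟨r, ⟨?_, hcor⟩, ?_⟩
    · by_contra h'
      have := μ.rowLen_anti n r (by omega)
      omega
    · apply YoungDiagram.ext
      rw [rm_cells μ r hcor]
      ext ⟨i, j⟩
      have a1 := hmem i j
      have a2 := hsub' i j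
      have a3 : s = μ.rowLen r - 1 := by omega
      rw [← a3]
      simp only [Finset.mem_erase, ne_eq, Prod.mk.injEq, YoungDiagram.mem_cells]
      tauto
  · rintro ⟨r, ⟨hr, h⟩, rfl⟩
    refine ⟨?_, ?_⟩
    · rw [rm_cells μ r h]
      exact Finset.erase_subset _ _
    · change μ.cells.card = (rm μ r).cells.card + 1
      rw [rm_cells μ r h, Finset.card_erase_add_one (corner_mem μ r h)]

theorem rm_inj (μ : YoungDiagram) (n : ℕ) : Set.InjOn (rm μ)
    ((range n).filter (fun r => μ.rowLen (r + 1) < μ.rowLen r) : Finset ℕ) := by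
  intro a ha b hb hab
  simp only [Finset.coe_filter, Set.mem_ofPred_eq] at ha hb
  by_contra hne
  have h1 := congrArg YoungDiagram.cells hab
  rw [rm_cells μ a ha.2, rm_cells μ b hb.2] at h1
  have h2 := Finset.ext_iff.1 h1 (a, μ.rowLen a - 1)
  have := corner_mem μ a ha.2
  simp only [Finset.mem_erase, ne_eq, Prod.mk.injEq, this] at h2
  tauto

theorem exists_n (μ : YoungDiagram) : ∃ n, μ.rowLen n = 0 := by
  refine ⟨μ.colLen 0, ?_⟩
  have := cell_iff μ (μ.colLen 0) 0
  omega

theorem ph_rec (μ : YoungDiagram) :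
    ∑ᶠ l ∈ {l : YoungDiagram | AddCell l μ}, ph l = (t - t⁻¹) * contentPolyT μ * ph μ := by
  obtain ⟨n, hn⟩ := exists_n μ
  rw [addCell_set μ n hn, finsum_mem_image (rm_inj μ n), finsum_mem_coe_finset, ← tm_sum μ n hn,
    Finset.sum_mul, Finset.sum_filter]
  refine Finset.sum_congr rfl fun r hr => ?_
  rw [Finset.mem_range] at hr
  split_ifs with h
  · rw [ph_rm μ n r hn hr h, mul_comm]
  · have := μ.rowLen_anti r (r + 1) (Nat.le_succ r)
    rw [tm_zero μ n r hn hr (by omega), zero_mul]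

theorem addCell_finite (μ : YoungDiagram) : {l : YoungDiagram | AddCell l μ}.Finite := by
  obtain ⟨n, hn⟩ := exists_n μ
  rw [addCell_set μ n hn]
  exact (Finset.finite_toSet _).image _

/-- Uniqueness: any solution of the recursion for the toric brane in `ℂ³` is a scalar
multiple (namely `ψ_∅` times) of the hook-content solution. -/
theorem toric_brane_recursion_unique (γ : RatFunc ℚ) (ψ : YoungDiagram → RatFunc ℚ)
    (hrec : ∀ μ : YoungDiagram, μ.cells.Nonempty →
      (t - t⁻¹) * contentPolyT μ * ψ μ =
        γ * ∑ᶠ l ∈ {l : YoungDiagram | AddCell l μ}, ψ l) :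
    ∀ l : YoungDiagram,
      ψ l = ψ ⊥ * (γ ^ l.card * ∏ c ∈ l.cells,
        t ^ (-cellContent c) / (t ^ (hookLen l c : ℤ) - t ^ (-(hookLen l c : ℤ)))) := by
  suffices H : ∀ N : ℕ, ∀ l : YoungDiagram, l.card = N → ψ l = ψ ⊥ * (γ ^ l.card * ph l) from
    fun l => H _ l rfl
  intro N
  induction N with
  | zero =>
    intro l hl
    have hl' : l.cells = ∅ := Finset.card_eq_zero.1 hl
    have : l = ⊥ := YoungDiagram.ext (by rw [hl']; rfl)
    subst this
    rw [hl]
    simp [ph]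
  | succ N ih =>
    intro μ hμ
    have hne : μ.cells.Nonempty := by
      rw [← Finset.card_pos]
      change 0 < μ.card
      omega
    have h := hrec μ hne
    have hs : ∑ᶠ l ∈ {l : YoungDiagram | AddCell l μ}, ψ l
        = ψ ⊥ * γ ^ N * ∑ᶠ l ∈ {l : YoungDiagram | AddCell l μ}, ph l := by
      rw [mul_finsum_mem' _ _ (addCell_finite μ)]
      refine finsum_mem_congr rfl fun l hl => ?_
      have hc : l.card = N := by
        have := hl.2
        omega
      rw [ih l hc, hc]
      ring
    rw [hs, ph_rec] at h
    have h1 : t - t⁻¹ ≠ 0 := by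
      have := br_ne (a := 1) one_ne_zero
      simpa [br] using this
    have h2 := content_ne μ hne
    apply mul_left_cancel₀ (mul_ne_zero h1 h2)
    rw [h, hμ, pow_succ]
    ring
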